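/- Let m, n be positive integers with n ≥ m. Then the Ramsey number of a matching of size n versus the fan F_m satisfies r(nK_2, F_m) = 2n + m. That is: every red-blue coloring of the edges of the complete graph K_{2n+m} yields a red matching of size n or a blue copy of F_m, and there is a red-blue coloring of the edges of K_{2n+m-1} yielding neither. -/

import Mathlib

/-- The fan `F n`: vertex `0` is the center, adjacent to all other `2n` vertices,
and the vertices `2i+1`, `2i+2` (for `0 ≤ i < n`) form `n` pairwise disjoint edges. -/
def fanGraph (n : ℕ) : SimpleGraph (Fin (2 * n + 1)) :=
  SimpleGraph.fromRel (fun a b => a.val = 0 ∨ (a.val % 2 = 1 ∧ b.val = a.val + 1))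

/-- The graph `n K₂`: a perfect matching on `2n` vertices, with edges
`{2i, 2i+1}` for `0 ≤ i < n`. -/
def matchingGraph (n : ℕ) : SimpleGraph (Fin (2 * n)) :=
  SimpleGraph.fromRel (fun a b => a.val % 2 = 0 ∧ b.val = a.val + 1)

/-- `H` is contained in `G` as a (not necessarily induced) subgraph. -/
def Contains {α β : Type*} (H : SimpleGraph α) (G : SimpleGraph β) : Prop :=
  ∃ f : α → β, Function.Injective f ∧ ∀ ⦃a b⦄, H.Adj a b → G.Adj (f a) (f b)
/-- The graph `G` has `n` pairwise disjoint edges `p i`–`q i` inside the vertex set `s`. -/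
def HasMatching {V : Type*} (G : SimpleGraph V) (s : Finset V) (n : ℕ) : Prop :=
  ∃ p q : Fin n → V, (∀ i, p i ∈ s) ∧ (∀ i, q i ∈ s) ∧ Function.Injective p ∧
    Function.Injective q ∧ (∀ i j, p i ≠ q j) ∧ ∀ i, G.Adj (p i) (q i)

namespace HasMatching

variable {V : Type*} {G : SimpleGraph V} {s t : Finset V} {n : ℕ}

theorem zero (G : SimpleGraph V) (s : Finset V) : HasMatching G s 0 :=
  ⟨Fin.elim0, Fin.elim0, fun i => i.elim0, fun i => i.elim0, fun i => i.elim0,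
    fun i => i.elim0, fun i => i.elim0, fun i => i.elim0⟩

theorem mono (h : HasMatching G s n) (hst : s ⊆ t) : HasMatching G t n := by
  obtain ⟨p, q, hp, hq, h⟩ := h
  exact ⟨p, q, fun i => hst (hp i), fun i => hst (hq i), h⟩

theorem cons [DecidableEq V] {a b : V} (ha : a ∈ s) (hb : b ∈ s) (hab : G.Adj a b)
    (h : HasMatching G ((s.erase a).erase b) n) : HasMatching G s (n + 1) := by
  obtain ⟨p, q, hp, hq, hpi, hqi, hpq, hadj⟩ := h
  simp only [Finset.mem_erase] at hp hq
  refine ⟨Fin.cons a p, Fin.cons b q, ?_, ?_, ?_, ?_, ?_, ?_⟩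
  · exact Fin.cases ha fun i => (hp i).2.2
  · exact Fin.cases hb fun i => (hq i).2.2
  · exact Fin.cons_injective_iff.2 ⟨fun ⟨i, hi⟩ => (hp i).2.1 hi, hpi⟩
  · exact Fin.cons_injective_iff.2 ⟨fun ⟨i, hi⟩ => (hq i).1 hi, hqi⟩
  · refine Fin.cases (Fin.cases hab.ne fun j => ?_) fun i => Fin.cases ?_ fun j => hpq i j
    · exact (hq j).2.1.symm
    · exact (hp i).1
  · exact Fin.cases hab hadj

theorem contains_matchingGraph (h : HasMatching G s n) : Contains (matchingGraph n) G := by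
  obtain ⟨p, q, -, -, hpi, hqi, hpq, hadj⟩ := h
  let f : Fin (2 * n) → V := fun a =>
    if a.val % 2 = 0 then p ⟨a.val / 2, by omega⟩ else q ⟨a.val / 2, by omega⟩
  have key : ∀ a b : Fin (2 * n), a.val % 2 = 0 → b.val = a.val + 1 → G.Adj (f a) (f b) := by
    intro a b ha hb
    have hb' : ¬ b.val % 2 = 0 := by omega
    have he : (⟨b.val / 2, by omega⟩ : Fin n) = ⟨a.val / 2, by omega⟩ := by
      ext; simp only; omega
    simp only [f, if_pos ha, if_neg hb', he]
    exact hadj _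
  refine ⟨f, ?_, ?_⟩
  · intro a b hab
    simp only [f] at hab
    split_ifs at hab with h1 h2 h2
    · have := congrArg Fin.val (hpi hab)
      simp only at this
      ext; omega
    · exact absurd hab (hpq _ _)
    · exact absurd hab.symm (hpq _ _)
    · have := congrArg Fin.val (hqi hab)
      simp only at this
      ext; omega
  · intro a b hab
    rw [matchingGraph, SimpleGraph.fromRel_adj] at hab
    obtain ⟨-, ⟨h1, h2⟩ | ⟨h1, h2⟩⟩ := hab
    · exact key a b h1 h2
    · exact (key b a h1 h2).symm

theorem contains_fanGraph {v : V} (hv : ∀ w ∈ s, G.Adj v w) (h : HasMatching G s n) :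
    Contains (fanGraph n) G := by
  obtain ⟨p, q, hp, hq, hpi, hqi, hpq, hadj⟩ := h
  let f : Fin (2 * n + 1) → V := fun a =>
    if h0 : a.val = 0 then v
    else if a.val % 2 = 1 then p ⟨(a.val - 1) / 2, by omega⟩
    else q ⟨(a.val - 1) / 2, by omega⟩
  have hcenter : ∀ a b : Fin (2 * n + 1), a.val = 0 → b.val ≠ 0 → G.Adj (f a) (f b) := by
    intro a b ha hb
    simp only [f, dif_pos ha, dif_neg hb]
    split_ifs
    · exact hv _ (hp _)
    · exact hv _ (hq _)
  have hedge : ∀ a b : Fin (2 * n + 1), a.val % 2 = 1 → b.val = a.val + 1 →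
      G.Adj (f a) (f b) := by
    intro a b ha hb
    have ha0 : ¬ a.val = 0 := by omega
    have hb0 : ¬ b.val = 0 := by omega
    have hb' : ¬ b.val % 2 = 1 := by omega
    have he : (⟨(b.val - 1) / 2, by omega⟩ : Fin n) = ⟨(a.val - 1) / 2, by omega⟩ := by
      ext; simp only; omega
    simp only [f, dif_neg ha0, dif_neg hb0, if_pos ha, if_neg hb', he]
    exact hadj _
  refine ⟨f, ?_, ?_⟩
  · intro a b hab
    by_cases ha : a.val = 0
    · by_cases hb : b.val = 0
      · ext; omega
      · exact absurd hab (hcenter a b ha hb).ne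
    by_cases hb : b.val = 0
    · exact absurd hab.symm (hcenter b a hb ha).ne
    simp only [f, dif_neg ha, dif_neg hb] at hab
    split_ifs at hab with h1 h2 h2
    · have := congrArg Fin.val (hpi hab)
      simp only at this
      ext; omega
    · exact absurd hab (hpq _ _)
    · exact absurd hab.symm (hpq _ _)
    · have := congrArg Fin.val (hqi hab)
      simp only at this
      ext; omega
  · intro a b hab
    rw [fanGraph, SimpleGraph.fromRel_adj] at hab
    obtain ⟨hne, (h1 | ⟨h1, h2⟩) | (h1 | ⟨h1, h2⟩)⟩ := hab
    · exact hcenter a b h1 fun hb => hne (Fin.ext (h1.trans hb.symm))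
    · exact hedge a b h1 h2
    · exact (hcenter b a h1 fun ha => hne (Fin.ext (ha.trans h1.symm))).symm
    · exact (hedge b a h1 h2).symm

theorem of_isClique {W : Finset V} (hW : G.IsClique W) (hcard : 2 * n ≤ W.card) :
    HasMatching G W n := by
  classical
  induction n generalizing W with
  | zero => exact zero G W
  | succ n ih =>
    obtain ⟨a, ha, b, hb, hab⟩ := Finset.one_lt_card.1 (show 1 < W.card by omega)
    refine cons ha hb (hW ha hb hab) (ih (hW.subset fun x hx => ?_) ?_)
    · exact Finset.mem_of_mem_erase (Finset.mem_of_mem_erase hx)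
    · rw [Finset.card_erase_of_mem (Finset.mem_erase.2 ⟨hab.symm, hb⟩),
        Finset.card_erase_of_mem ha]
      omega

/-- If every vertex of `X` is adjacent to all but at most one vertex of the clique `W`, then the
vertices of `X` can be matched greedily into `W`, the rest of `W` being matched internally. -/
theorem union_isClique [DecidableEq V] {X W : Finset V} (hW : G.IsClique W)
    (hdisj : Disjoint X W) (hX : ∀ x ∈ X, ∃ u, ∀ w ∈ W, w ≠ u → G.Adj x w)
    (hcard : X.card + 2 * n ≤ W.card) (hlt : X.card < W.card) :
    HasMatching G (X ∪ W) (X.card + n) := by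
  induction X using Finset.induction_on generalizing W with
  | empty =>
    simp only [Finset.card_empty, zero_add, Finset.empty_union] at hcard ⊢
    exact of_isClique hW hcard
  | insert x X hx ih =>
    rw [Finset.card_insert_of_notMem hx] at hcard hlt ⊢
    rw [Finset.disjoint_insert_left] at hdisj
    obtain ⟨u, hu⟩ := hX x (Finset.mem_insert_self x X)
    obtain ⟨w, hw, hwu⟩ := Finset.exists_mem_ne (show 1 < W.card by omega) u
    have hWcard := Finset.card_erase_of_mem hw
    have hrec := ih (W := W.erase w) (hW.subset fun y hy => Finset.mem_of_mem_erase hy)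
      (hdisj.2.mono_right (Finset.erase_subset w W))
      (fun y hy => (hX y (Finset.mem_insert_of_mem hy)).imp fun z hz a ha =>
        hz a (Finset.mem_of_mem_erase ha)) (by omega) (by omega)
    rw [add_right_comm]
    refine cons (a := x) (b := w) (by simp) (by simp [hw]) (hu w hw hwu) (hrec.mono ?_)
    intro y hy
    have hwX : w ∉ X := fun h => Finset.disjoint_left.1 hdisj.2 h hw
    simp only [Finset.mem_union, Finset.mem_erase, Finset.mem_insert] at hy ⊢
    rcases hy with hy | hy
    · exact ⟨fun h => hwX (h ▸ hy), fun h => hx (h ▸ hy), Or.inl (Or.inr hy)⟩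
    · exact ⟨hy.1, fun h => hdisj.1 (h ▸ hy.2), Or.inr hy.2⟩

end HasMatching

/-- A matching avoiding `u` and `u'` can be enlarged along an alternating path
`u`–`p i`–`q i`–`u'`. -/
theorem HasMatching.augment {V : Type*} [Fintype V] {G : SimpleGraph V} {k : ℕ}
    {p q : Fin k → V} (hpi : Function.Injective p) (hqi : Function.Injective q)
    (hpq : ∀ i j, p i ≠ q j) (hadj : ∀ i, G.Adj (p i) (q i)) {u u' : V} (huu : u ≠ u')
    (hup : ∀ i, u ≠ p i) (huq : ∀ i, u ≠ q i) (hup' : ∀ i, u' ≠ p i) (huq' : ∀ i, u' ≠ q i)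
    {i : Fin k} (hpu : G.Adj (p i) u) (hqu : G.Adj (q i) u') :
    HasMatching G Finset.univ (k + 1) := by
  classical
  refine HasMatching.cons (Finset.mem_univ (q i)) (Finset.mem_univ u') hqu
    ⟨p, Function.update q i u, ?_, ?_, hpi, ?_, ?_, ?_⟩
  · intro j
    simp [(hup' j).symm, hpq j i]
  · intro j
    by_cases hj : j = i
    · subst hj; simp [huu, huq]
    · simp [hj, (huq' j).symm, hqi.eq_iff]
  · intro a b hab
    by_cases ha : a = i <;> by_cases hb : b = i
    · rw [ha, hb]
    · subst ha; simp [hb, huq] at hab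
    · subst hb; simp [ha, (huq _).symm] at hab
    · simpa [ha, hb, hqi.eq_iff] using hab
  · intro a b
    by_cases hb : b = i
    · subst hb; simpa using (hup a).symm
    · simpa [hb] using hpq a b
  · intro a
    by_cases ha : a = i
    · subst ha; simpa using hpu
    · simpa [ha] using hadj a

/-- Some member of `U` belongs to at most the average number of the pairwise disjoint sets `B v`. -/
theorem exists_card_mul_card_le {α β : Type*} [Fintype β] {U : Finset α}
    (hU : U.Nonempty) {B : α → Finset β} (hB : (U : Set α).PairwiseDisjoint B) :
    ∃ v ∈ U, (B v).card * U.card ≤ Fintype.card β := by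
  classical
  by_contra! h
  have hsum : ∑ v ∈ U, (B v).card ≤ Fintype.card β := by
    rw [← Finset.card_biUnion hB]
    exact Finset.card_le_univ _
  have hlt : ∑ _v ∈ U, Fintype.card β < ∑ v ∈ U, (B v).card * U.card :=
    Finset.sum_lt_sum_of_nonempty hU h
  rw [Finset.sum_const, smul_eq_mul, ← Finset.sum_mul, mul_comm] at hlt
  exact absurd (Nat.lt_of_mul_lt_mul_right hlt) (not_lt.2 hsum)

theorem contains_matchingGraph_or_contains_fanGraph_compl {V : Type*} [Fintype V] {m n : ℕ}
    (hm : 0 < m) (hmn : m ≤ n) (hV : Fintype.card V = 2 * n + m) (G : SimpleGraph V) :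
    Contains (matchingGraph n) G ∨ Contains (fanGraph m) Gᶜ := by
  classical
  by_cases hmat : HasMatching G Finset.univ n
  · exact Or.inl hmat.contains_matchingGraph
  right
  obtain ⟨k, hkn, ⟨p, q, -, -, hpi, hqi, hpq, hadj⟩, hmax⟩ : ∃ k < n,
      HasMatching G Finset.univ k ∧ ¬ HasMatching G Finset.univ (k + 1) := by
    by_contra! hstep
    have hall : ∀ k ≤ n, HasMatching G Finset.univ k := by
      intro k
      induction k with
      | zero => exact fun _ => HasMatching.zero G _
      | succ k ih => exact fun hk => hstep k (by omega) (ih (by omega))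
    exact hmat (hall n le_rfl)
  set M : Finset V := Finset.univ.image p ∪ Finset.univ.image q with hM
  set U : Finset V := Mᶜ with hU
  have hMcard : M.card = 2 * k := by
    rw [hM, Finset.card_union_of_disjoint, Finset.card_image_of_injective _ hpi,
      Finset.card_image_of_injective _ hqi, Finset.card_univ, Fintype.card_fin, two_mul]
    simp only [Finset.disjoint_left, Finset.mem_image, Finset.mem_univ, true_and, not_exists]
    rintro _ ⟨i, rfl⟩ j hj
    exact hpq i j hj.symm
  have hUcard : U.card = 2 * n + m - 2 * k := by
    rw [hU, Finset.card_compl, hV, hMcard]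
  have hpM : ∀ i, p i ∈ M := fun i => by simp [hM]
  have hqM : ∀ i, q i ∈ M := fun i => by simp [hM]
  have hneM : ∀ {u w}, u ∈ U → w ∈ M → u ≠ w := fun hu hw h =>
    Finset.mem_compl.1 hu (h ▸ hw)
  have hUclique : Gᶜ.IsClique U := by
    intro a ha b hb hab
    rw [SimpleGraph.compl_adj]
    refine ⟨hab, fun h => hmax ?_⟩
    refine HasMatching.cons (Finset.mem_univ a) (Finset.mem_univ b) h
      ⟨p, q, fun i => ?_, fun i => ?_, hpi, hqi, hpq, hadj⟩
    · simp [(hneM ha (hpM i)).symm, (hneM hb (hpM i)).symm]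
    · simp [(hneM ha (hqM i)).symm, (hneM hb (hqM i)).symm]
  have haug : ∀ i, ∀ u ∈ U, ∀ u' ∈ U, G.Adj (p i) u → G.Adj (q i) u' → u = u' := by
    intro i u hu u' hu' h h'
    by_contra hne
    exact hmax (HasMatching.augment hpi hqi hpq hadj hne (fun j => hneM hu (hpM j))
      (fun j => hneM hu (hqM j)) (fun j => hneM hu' (hpM j)) (fun j => hneM hu' (hqM j)) h h')
  let B : V → Finset (Fin k) := fun v =>
    Finset.univ.filter fun i => G.Adj (p i) v ∧ G.Adj (q i) v
  have hBdisj : (U : Set V).PairwiseDisjoint B := by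
    intro u hu u' hu' hne
    rw [Function.onFun, Finset.disjoint_left]
    intro i hi hi'
    simp only [B, Finset.mem_filter, Finset.mem_univ, true_and] at hi hi'
    exact hne (haug i u hu u' hu' hi.1 hi'.2)
  obtain ⟨v, hvU, hv⟩ := exists_card_mul_card_le (Finset.card_pos.1 (by omega)) hBdisj
  rw [Fintype.card_fin] at hv
  have hchoice : ∀ i : Fin k, ∃ x, (x = p i ∨ x = q i) ∧ (i ∉ B v → ¬ G.Adj x v ∧
      ∃ u, ∀ w ∈ U, w ≠ u → ¬ G.Adj x w) := by
    intro i
    by_cases hp0 : ∃ u ∈ U, G.Adj (p i) u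
    · by_cases hq0 : ∃ u ∈ U, G.Adj (q i) u
      · obtain ⟨u, hu, hpu⟩ := hp0
        obtain ⟨u', hu', hqu⟩ := hq0
        obtain rfl := haug i u hu u' hu' hpu hqu
        refine ⟨p i, Or.inl rfl, fun hi => ⟨fun h => hi ?_, u, fun w hw hwu h =>
          hwu (haug i w hw u hu h hqu)⟩⟩
        obtain rfl := haug i v hvU u hu h hqu
        simp [B, hpu, hqu]
      · push Not at hq0
        exact ⟨q i, Or.inr rfl, fun _ => ⟨hq0 v hvU, v, fun w hw _ => hq0 w hw⟩⟩
    · push Not at hp0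
      exact ⟨p i, Or.inl rfl, fun _ => ⟨hp0 v hvU, v, fun w hw _ => hp0 w hw⟩⟩
  choose x hx hxgood using hchoice
  have hxM : ∀ i, x i ∈ M := fun i => by
    rcases hx i with h | h <;> rw [h]
    exacts [hpM i, hqM i]
  have hxi : Function.Injective x := by
    intro i j hij
    rcases hx i with h | h <;> rcases hx j with h' | h' <;> rw [h, h'] at hij
    · exact hpi hij
    · exact absurd hij (hpq _ _)
    · exact absurd hij.symm (hpq _ _)
    · exact hqi hij
  have hWcard : (U.erase v).card = 2 * n + m - 2 * k - 1 := by
    rw [Finset.card_erase_of_mem hvU, hUcard]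
  have hgood : (B v)ᶜ.card = k - (B v).card := by
    rw [Finset.card_compl, Fintype.card_fin]
  have hblue : ∀ I : Finset (Fin k), I ⊆ (B v)ᶜ → ∀ t, I.card + 2 * t ≤ (U.erase v).card →
      I.card < (U.erase v).card → I.card + t = m → Contains (fanGraph m) Gᶜ := by
    intro I hI t ht hlt hIm
    have hIcard : (I.image x).card = I.card := Finset.card_image_of_injective _ hxi
    have hmatch : HasMatching Gᶜ (I.image x ∪ U.erase v) ((I.image x).card + t) := by
      refine HasMatching.union_isClique
        (hUclique.subset fun y hy => Finset.mem_of_mem_erase hy) ?_ ?_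
        (by rwa [hIcard]) (by rwa [hIcard])
      · rw [Finset.disjoint_left]
        intro y hy hyU
        obtain ⟨i, -, rfl⟩ := Finset.mem_image.1 hy
        exact hneM (Finset.mem_of_mem_erase hyU) (hxM i) rfl
      · intro y hy
        obtain ⟨i, hi, rfl⟩ := Finset.mem_image.1 hy
        obtain ⟨u, hu⟩ := (hxgood i (Finset.mem_compl.1 (hI hi))).2
        refine ⟨u, fun w hw hwu => ?_⟩
        have hw' := Finset.mem_of_mem_erase hw
        exact (SimpleGraph.compl_adj _ _ _).2 ⟨(hneM hw' (hxM i)).symm, hu w hw' hwu⟩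
    rw [hIcard, hIm] at hmatch
    refine hmatch.contains_fanGraph (v := v) fun w hw => ?_
    rcases Finset.mem_union.1 hw with hw | hw
    · obtain ⟨i, hi, rfl⟩ := Finset.mem_image.1 hw
      exact (SimpleGraph.compl_adj _ _ _).2 ⟨hneM hvU (hxM i), fun h =>
        (hxgood i (Finset.mem_compl.1 (hI hi))).1 h.symm⟩
    · exact hUclique hvU (Finset.mem_of_mem_erase hw) (Finset.ne_of_mem_erase hw).symm
  by_cases hk : m ≤ k - (B v).card
  · obtain ⟨I, hI, hIcard⟩ := Finset.exists_subset_card_eq (hgood ▸ hk)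
    exact hblue I hI 0 (by omega) (by omega) (by omega)
  · have hB0 : (B v).card = 0 := by
      by_contra hne
      have h1 : (B v).card * (m + 2) ≤ k := (Nat.mul_le_mul_left _ (by omega)).trans hv
      have h2 : 1 * (m + 1) ≤ (B v).card * (m + 1) := Nat.mul_le_mul_right _ (by omega)
      have h3 : (B v).card * (m + 2) = (B v).card * (m + 1) + (B v).card := by ring
      omega
    exact hblue (B v)ᶜ subset_rfl (m - k) (by omega) (by omega) (by omega)

/-- The graph on `Fin N` whose edges join the distinct vertices below `c`. -/
def initialClique (N c : ℕ) : SimpleGraph (Fin N) :=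
  SimpleGraph.fromRel fun a b => a.val < c ∧ b.val < c

theorem initialClique_adj {N c : ℕ} {a b : Fin N} :
    (initialClique N c).Adj a b ↔ a ≠ b ∧ a.val < c ∧ b.val < c := by
  simp only [initialClique, SimpleGraph.fromRel_adj]
  tauto

theorem not_contains_matchingGraph_initialClique {N c n : ℕ} (hc : c < 2 * n) :
    ¬ Contains (matchingGraph n) (initialClique N c) := by
  rintro ⟨f, hf, hadj⟩
  have hlt : ∀ a, (f a).val < c := by
    intro a
    rcases Nat.mod_two_eq_zero_or_one a.val with ha | ha
    · have h : (matchingGraph n).Adj a ⟨a.val + 1, by omega⟩ := by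
        rw [matchingGraph, SimpleGraph.fromRel_adj]
        exact ⟨fun h => by simpa using congrArg Fin.val h, Or.inl ⟨ha, rfl⟩⟩
      exact (initialClique_adj.1 (hadj h)).2.1
    · have h : (matchingGraph n).Adj ⟨a.val - 1, by omega⟩ a := by
        rw [matchingGraph, SimpleGraph.fromRel_adj]
        refine ⟨fun h => ?_, Or.inl ⟨?_, ?_⟩⟩
        · have := congrArg Fin.val h
          simp only at this
          omega
        · simp only; omega
        · simp only; omega
      exact (initialClique_adj.1 (hadj h)).2.2
  have hcard := Fintype.card_le_of_injective (fun a => (⟨(f a).val, hlt a⟩ : Fin c))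
    fun a b hab => hf (Fin.ext (Fin.mk.inj hab))
  simp only [Fintype.card_fin] at hcard
  omega

theorem not_contains_fanGraph_compl_initialClique {N c m : ℕ} (hm : 0 < m) (hN : N ≤ c + m) :
    ¬ Contains (fanGraph m) (initialClique N c)ᶜ := by
  rintro ⟨f, hf, hadj⟩
  have hlarge : ∀ a b, (fanGraph m).Adj a b → c ≤ (f a).val ∨ c ≤ (f b).val := by
    intro a b hab
    have h := hadj hab
    rw [SimpleGraph.compl_adj, initialClique_adj] at h
    by_contra! hlt
    exact h.2 ⟨h.1, hlt⟩
  have hbound : ∀ {j : ℕ} (g : Fin j → Fin (2 * m + 1)), Function.Injective g →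
      (∀ i, c ≤ (f (g i)).val) → j ≤ m := by
    intro j g hg hgc
    have hcard := Fintype.card_le_of_injective
      (fun i => (⟨(f (g i)).val - c, by have := hgc i; omega⟩ : Fin m)) fun a b hab => by
        have h1 := congrArg Fin.val hab
        have h2 := hgc a
        have h3 := hgc b
        simp only at h1
        exact hg (hf (Fin.ext (by omega)))
    simpa using hcard
  by_cases h0 : c ≤ (f 0).val
  · have hpair : ∀ i : Fin m, ∃ a : Fin (2 * m + 1),
        (a.val = 2 * i.val + 1 ∨ a.val = 2 * i.val + 2) ∧ c ≤ (f a).val := by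
      intro i
      have h : (fanGraph m).Adj ⟨2 * i.val + 1, by omega⟩ ⟨2 * i.val + 2, by omega⟩ := by
        rw [fanGraph, SimpleGraph.fromRel_adj]
        refine ⟨by simp, Or.inl (Or.inr ⟨?_, rfl⟩)⟩
        simp only; omega
      rcases hlarge _ _ h with h | h
      exacts [⟨_, Or.inl rfl, h⟩, ⟨_, Or.inr rfl, h⟩]
    choose g hg hgc using hpair
    have h := hbound (Fin.cons 0 g : Fin (m + 1) → Fin (2 * m + 1)) ?_ (Fin.cases h0 hgc)
    · omega
    · refine Fin.cons_injective_iff.2 ⟨?_, fun a b hab => ?_⟩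
      · rintro ⟨i, hi⟩
        have h1 := hg i
        rw [hi, Fin.val_zero] at h1
        omega
      · have h1 := hg a
        have h2 := hg b
        rw [hab] at h1
        ext; omega
  · have h := hbound (Fin.succ : Fin (2 * m) → Fin (2 * m + 1)) (Fin.succ_injective _)
      fun i => ?_
    · omega
    · have h : (fanGraph m).Adj 0 i.succ := by
        rw [fanGraph, SimpleGraph.fromRel_adj]
        exact ⟨(Fin.succ_ne_zero i).symm, Or.inl (Or.inl rfl)⟩
      exact (hlarge _ _ h).resolve_left h0

/-- `r(nK₂, F_m) = 2n + m` for `n ≥ m ≥ 1`: every red-blue coloring of the edges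
of `K_{2n+m}` (the red graph being `G`, the blue one its complement) yields a red
matching of size `n` or a blue copy of the fan `F_m`, and there is a red-blue
coloring of the edges of `K_{2n+m-1}` yielding neither. -/
theorem ramsey_matching_fan (m n : ℕ) (hm : 0 < m) (hn : 0 < n) (hmn : m ≤ n) :
    (∀ G : SimpleGraph (Fin (2 * n + m)),
        Contains (matchingGraph n) G ∨ Contains (fanGraph m) Gᶜ) ∧
    (∃ G : SimpleGraph (Fin (2 * n + m - 1)),
        ¬ Contains (matchingGraph n) G ∧ ¬ Contains (fanGraph m) Gᶜ) := by
  exact ⟨fun G => contains_matchingGraph_or_contains_fanGraph_compl hm hmn (Fintype.card_fin _) G,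
    initialClique _ (2 * n - 1), not_contains_matchingGraph_initialClique (by omega),
    not_contains_fanGraph_compl_initialClique hm (by omega)⟩
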